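/- arXiv:1208.1813 — 11 statements merged into one kernel-verified Lean document; each statement's English description precedes it below -/
import Mathlib

section
/- For all a, b ∈ ℂ and all w ∈ ℂ⁵, the determinant of the 5×5 complex matrix whose k-th column is A_k·w (that is, the matrix with rows (w₁+bw₂,0,0,0,aw₅), (aw₁,w₂+bw₃,0,0,0), (0,aw₂,w₃+bw₄,0,0), (0,0,aw₃,w₄+bw₅,0), (0,0,0,aw₄,w₅+bw₁)) equals a⁵·w₁w₂w₃w₄w₅ + ∏_{i=1}^{5}(w_i + b·w_{i+1}), where the index i+1 is taken cyclically modulo 5. -/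
open Matrix

/-- The matrix `A_k` (for parameters `a`, `b`): `(A_k)_{k,k} = 1`, `(A_k)_{k,k+1} = b`,
`(A_k)_{k+1,k} = a`, indices cyclic mod 5, all other entries `0`. -/
noncomputable def Amat (a b : ℂ) (k : Fin 5) : Matrix (Fin 5) (Fin 5) ℂ :=
  fun i j =>
    (if i = k ∧ j = k then 1 else 0) + (if i = k ∧ j = k + 1 then b else 0) +
      (if i = k + 1 ∧ j = k then a else 0)

/-- The column `A_k · w` is `(w_k + b·w_{k+1}) e_k + a·w_k e_{k+1}`. -/
theorem Amat_mulVec_apply (a b : ℂ) (k : Fin 5) (w : Fin 5 → ℂ) (i : Fin 5) :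
    (Amat a b k).mulVec w i =
      (if i = k then w k + b * w (k + 1) else 0) + (if i = k + 1 then a * w k else 0) := by
  simp only [Amat, Matrix.mulVec, dotProduct, add_mul, Finset.sum_add_distrib, ite_and, ite_mul,
    zero_mul, one_mul]
  by_cases h : i = k <;> by_cases h' : i = k + 1 <;> simp [h, h']

/-- The determinant of the 5×5 matrix whose `k`-th column is `A_k · w` equals
`a⁵·w₁w₂w₃w₄w₅ + ∏ᵢ (wᵢ + b·w_{i+1})` (indices cyclic mod 5). -/
theorem det_column_Amat_mulVec (a b : ℂ) (w : Fin 5 → ℂ) :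
    (Matrix.of fun i k => (Amat a b k).mulVec w i).det =
      a ^ 5 * (w 0 * w 1 * w 2 * w 3 * w 4) + ∏ i : Fin 5, (w i + b * w (i + 1)) := by
  have h : (Matrix.of fun i k => (Amat a b k).mulVec w i) =
      !![w 0 + b * w 1, 0, 0, 0, a * w 4;
        a * w 0, w 1 + b * w 2, 0, 0, 0;
        0, a * w 1, w 2 + b * w 3, 0, 0;
        0, 0, a * w 2, w 3 + b * w 4, 0;
        0, 0, 0, a * w 3, w 4 + b * w 0] := by
    ext i k
    rw [Matrix.of_apply, Amat_mulVec_apply]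
    fin_cases i <;> fin_cases k <;> simp [Fin.ext_iff]
  rw [h]
  simp [Matrix.det_succ_row_zero, Fin.sum_univ_succ, Fin.succAbove, Fin.prod_univ_five]
  ring
end

section
/- For all a, b ∈ ℂ and all λ = (λ₁,…,λ₅) ∈ ℂ⁵, det(λ₁A₁ + λ₂A₂ + λ₃A₃ + λ₄A₄ + λ₅A₅) = (1 + a⁵ + b⁵)·λ₁λ₂λ₃λ₄λ₅ + a²b²·Σ_{i=1}^{5} λ_i λ_{i+1}² λ_{i+3}² − a·b·Σ_{i=1}^{5} λ_i λ_{i+1} λ_{i+2} λ_{i+3}², where all indices are taken cyclically modulo 5. -/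
open Matrix

/-- `det(Σ_k λ_k A_k) = (1 + a⁵ + b⁵)·λ₁λ₂λ₃λ₄λ₅ + a²b²·Σᵢ λᵢλ_{i+1}²λ_{i+3}²
− ab·Σᵢ λᵢλ_{i+1}λ_{i+2}λ_{i+3}²` (indices cyclic mod 5). -/
theorem det_sum_smul_Amat (a b : ℂ) (lam : Fin 5 → ℂ) :
    (∑ k : Fin 5, lam k • Amat a b k).det =
      (1 + a ^ 5 + b ^ 5) * ∏ i : Fin 5, lam i +
        a ^ 2 * b ^ 2 * ∑ i : Fin 5, lam i * lam (i + 1) ^ 2 * lam (i + 3) ^ 2 -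
        a * b * ∑ i : Fin 5, lam i * lam (i + 1) * lam (i + 2) * lam (i + 3) ^ 2 := by
  have h : ∑ k : Fin 5, lam k • Amat a b k =
      !![lam 0, b * lam 0, 0, 0, a * lam 4;
        a * lam 0, lam 1, b * lam 1, 0, 0;
        0, a * lam 1, lam 2, b * lam 2, 0;
        0, 0, a * lam 2, lam 3, b * lam 3;
        b * lam 4, 0, 0, a * lam 3, lam 4] := by
    ext i j
    fin_cases i <;> fin_cases j <;>
      simp [Fin.sum_univ_five, Amat, Matrix.add_apply, Fin.ext_iff, mul_comm]
  rw [h]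
  simp [Matrix.det_succ_row_zero, Fin.sum_univ_succ, Fin.prod_univ_succ, Fin.succAbove]
  ring
end

section
/- Let a, b ∈ ℂ with a ≠ 0, b ≠ 0, and suppose that ζ·a + η·b + 1 ≠ 0 for all ζ, η ∈ ℂ with ζ⁵ = η⁵ = 1. Then for every pair z, w ∈ ℂ⁵ with all coordinates z_i and w_i nonzero and satisfying f₁(z,w) = f₂(z,w) = f₃(z,w) = f₄(z,w) = f₅(z,w) = 0, the 5×10 Jacobian matrix J(z,w), with entries J_{k,j} = ∂f_k/∂z_j and J_{k,5+j} = ∂f_k/∂w_j (1 ≤ j ≤ 5), has rank 5. (Equivalently, the restriction of the complete intersection X̃₀^sp to the torus (ℂ*)⁴×(ℂ*)⁴ is smooth when the discriminant ∏_{k,l=0}^{4}(μᵏa + μˡb + 1) does not vanish.) -/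
open Matrix

/-- `f_k(z,w) = z_k w_k + a·z_{k+1} w_k + b·z_k w_{k+1}` (indices cyclic mod 5). -/
def fEq (a b : ℂ) (z w : Fin 5 → ℂ) (k : Fin 5) : ℂ :=
  z k * w k + a * z (k + 1) * w k + b * z k * w (k + 1)

/-- The 5×10 Jacobian matrix of `(f₁,…,f₅)` at `(z,w)`: entry `(k, inl j)` is
`∂f_k/∂z_j` and entry `(k, inr j)` is `∂f_k/∂w_j`. -/
def Jac (a b : ℂ) (z w : Fin 5 → ℂ) : Matrix (Fin 5) (Fin 5 ⊕ Fin 5) ℂ :=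
  fun k => Sum.elim
    (fun j => (if j = k then w k + b * w (k + 1) else 0) + (if j = k + 1 then a * w k else 0))
    (fun j => (if j = k then z k + a * z (k + 1) else 0) + (if j = k + 1 then b * z k else 0))

/-- A function on `Fin 5` invariant under the cyclic shift is constant. -/
lemma eq_zero_index_of_shift_invariant {α : Type*} {g : Fin 5 → α} (h : ∀ k, g (k + 1) = g k)
    (k : Fin 5) : g k = g 0 := by
  have h0 := h 0
  have h1 := h 1
  have h2 := h 2
  have h3 := h 3
  fin_cases k <;> simp_all

/-- The successive ratios of nonzero cyclically indexed numbers multiply to `1`. -/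
lemma prod_cyclic_ratio {z : Fin 5 → ℂ} (hz : ∀ i, z i ≠ 0) : ∏ k, z (k + 1) / z k = 1 := by
  have h : ∏ k, z (k + 1) = ∏ k, z k := Equiv.prod_comp (Equiv.addRight (1 : Fin 5)) z
  rw [Finset.prod_div_distrib, h]
  exact div_self (Finset.prod_ne_zero_iff.mpr fun i _ => hz i)

lemma vecMul_Jac_inl (a b : ℂ) (z w c : Fin 5 → ℂ) (k : Fin 5) :
    (c ᵥ* Jac a b z w) (Sum.inl (k + 1)) =
      c (k + 1) * (w (k + 1) + b * w (k + 1 + 1)) + c k * (a * w k) := by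
  simp [Matrix.vecMul, dotProduct, Jac, mul_add, Finset.sum_add_distrib]

lemma vecMul_Jac_inr (a b : ℂ) (z w c : Fin 5 → ℂ) (k : Fin 5) :
    (c ᵥ* Jac a b z w) (Sum.inr (k + 1)) =
      c (k + 1) * (z (k + 1) + a * z (k + 1 + 1)) + c k * (b * z k) := by
  simp [Matrix.vecMul, dotProduct, Jac, mul_add, Finset.sum_add_distrib]

/-- On the torus, a nonzero vector in the left kernel of the Jacobian forces the ratios
`z (k + 1) / z k` and `w (k + 1) / w k` to be fifth roots of unity independent of `k`. -/
lemma exists_roots_of_vecMul_Jac_eq_zero {a b : ℂ} (ha : a ≠ 0) (hb : b ≠ 0)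
    {z w : Fin 5 → ℂ} (hz : ∀ i, z i ≠ 0) (hw : ∀ i, w i ≠ 0) (hf : ∀ k, fEq a b z w k = 0)
    {c : Fin 5 → ℂ} (hc : c ᵥ* Jac a b z w = 0) (hc0 : c ≠ 0) :
    ∃ ζ η : ℂ, ζ ^ 5 = 1 ∧ η ^ 5 = 1 ∧ ζ * a + η * b + 1 = 0 := by
  set x : Fin 5 → ℂ := fun k => z (k + 1) / z k with hx
  set y : Fin 5 → ℂ := fun k => w (k + 1) / w k with hy
  have hx0 : ∀ k, x k ≠ 0 := fun k => div_ne_zero (hz _) (hz _)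
  have hxy : ∀ k, x k * a + y k * b + 1 = 0 := fun k => by
    have h := hf k
    have h1 := hz k
    have h2 := hw k
    simp only [fEq] at h
    simp only [hx, hy]
    field_simp
    linear_combination h
  have hcx : ∀ k, c k * (z (k + 1) * w k) = c 0 * (z (0 + 1) * w 0) :=
    eq_zero_index_of_shift_invariant (g := fun k => c k * (z (k + 1) * w k)) fun k => by
      have h := congrFun hc (Sum.inl (k + 1))
      rw [vecMul_Jac_inl, Pi.zero_apply] at h
      have h' := hf (k + 1)
      simp only [fEq] at h'
      apply mul_left_cancel₀ ha
      linear_combination c (k + 1) * h' - z (k + 1) * h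
  have hcy : ∀ k, c k * (z k * w (k + 1)) = c 0 * (z 0 * w (0 + 1)) :=
    eq_zero_index_of_shift_invariant (g := fun k => c k * (z k * w (k + 1))) fun k => by
      have h := congrFun hc (Sum.inr (k + 1))
      rw [vecMul_Jac_inr, Pi.zero_apply] at h
      have h' := hf (k + 1)
      simp only [fEq] at h'
      apply mul_left_cancel₀ hb
      linear_combination c (k + 1) * h' - w (k + 1) * h
  have hc00 : c 0 ≠ 0 := fun h0 => hc0 <| funext fun k => by
    have h := hcx k
    rw [h0, zero_mul] at h
    exact (mul_eq_zero.mp h).resolve_right (mul_ne_zero (hz _) (hw _))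
  have hck : ∀ k, c k ≠ 0 := fun k h0 => by
    have h := hcx k
    rw [h0, zero_mul, eq_comm] at h
    exact mul_ne_zero hc00 (mul_ne_zero (hz _) (hw _)) h
  have hcross : ∀ k, x k * y 0 = y k * x 0 := fun k => by
    have h1 := hcx k
    have h2 := hcy k
    have := hz k
    have := hw k
    have := hz 0
    have := hw 0
    simp only [hx, hy]
    field_simp
    apply mul_left_cancel₀ (mul_ne_zero (hck k) hc00)
    linear_combination (c 0 * (z 0 * w (0 + 1))) * h1 - (c 0 * (z (0 + 1) * w 0)) * h2
  have hxc : ∀ k, x k = x 0 := fun k => by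
    linear_combination x k * hxy 0 - x 0 * hxy k - b * hcross k
  have hyc : ∀ k, y k = y 0 := fun k => by
    apply mul_right_cancel₀ (hx0 0)
    rw [← hcross k, hxc k, mul_comm]
  refine ⟨x 0, y 0, ?_, ?_, hxy 0⟩
  · have h : ∏ k, x k = 1 := prod_cyclic_ratio hz
    simpa [hxc] using h
  · have h : ∏ k, y k = 1 := prod_cyclic_ratio hw
    simpa [hyc] using h

/-- If `a, b ≠ 0` and `ζa + ηb + 1 ≠ 0` for all fifth roots of unity `ζ, η`, then at every
point of the torus `(ℂ*)⁵ × (ℂ*)⁵` where all five equations `f_k = 0` hold, the 5×10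
Jacobian has rank 5 (smoothness of `X̃₀^sp` on the torus). -/
theorem jacobian_rank_five_of_discriminant_ne_zero (a b : ℂ) (ha : a ≠ 0) (hb : b ≠ 0)
    (hdisc : ∀ ζ η : ℂ, ζ ^ 5 = 1 → η ^ 5 = 1 → ζ * a + η * b + 1 ≠ 0)
    (z w : Fin 5 → ℂ) (hz : ∀ i, z i ≠ 0) (hw : ∀ i, w i ≠ 0)
    (hf : ∀ k, fEq a b z w k = 0) :
    (Jac a b z w).rank = 5 := by
  have hli : LinearIndependent ℂ (Jac a b z w).row := by
    rw [← Matrix.vecMul_injective_iff, ← Matrix.coe_vecMulLinear, injective_iff_map_eq_zero]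
    intro c hc
    by_contra hc0
    obtain ⟨ζ, η, hζ, hη, h⟩ := exists_roots_of_vecMul_Jac_eq_zero ha hb hz hw hf hc hc0
    exact hdisc ζ η hζ hη h
  simpa using hli.rank_matrix
end

section
/- Let a, b ∈ ℂ with a ≠ 0, b ≠ 0, and suppose that ζ·a + η·b + 1 ≠ 0 for all ζ, η ∈ ℂ with ζ⁵ = η⁵ = 1. Define F(w) = a⁵·w₁w₂w₃w₄w₅ + ∏_{i=1}^{5}(w_i + b·w_{i+1}) (indices cyclic mod 5). Then there is no w ∈ ℂ⁵ with all coordinates w_i nonzero at which all five partial derivatives ∂F/∂w_i vanish. (Equivalently, the restriction of the determinantal quintic Z₂^sp to the torus (ℂ*)⁴ ⊂ ℙ⁴ is smooth when its discriminant a⁵·∏_{k,l=0}^{4}(μᵏa + μˡb + 1) does not vanish.) -/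
open MvPolynomial

/-- The defining quintic `F(w) = a⁵·w₀w₁w₂w₃w₄ + ∏ᵢ (wᵢ + b·w_{i+1})` of the special
determinantal (Steinerian) quintic `Z₂^sp`, as a polynomial in the variables `w_i`
(indices cyclic mod 5). -/
noncomputable def Fquintic (a b : ℂ) : MvPolynomial (Fin 5) ℂ :=
  C (a ^ 5) * ∏ i : Fin 5, X i + ∏ i : Fin 5, (X i + C b * X (i + 1))

/-- The partial derivatives of the defining quintic at `w`. -/
theorem eval_pderiv_Fquintic (a b : ℂ) (w : Fin 5 → ℂ) (i : Fin 5) :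
    eval w (pderiv i (Fquintic a b)) =
      a ^ 5 * (w (i + 1) * w (i + 2) * w (i + 3) * w (i + 4)) +
        (w (i + 1) + b * w (i + 2)) * (w (i + 2) + b * w (i + 3)) *
          (w (i + 3) + b * w (i + 4)) *
          ((w (i + 4) + b * w i) + b * (w i + b * w (i + 1))) := by
  fin_cases i <;>
  · simp [Fquintic, Fin.prod_univ_five, pderiv_X, Derivation.leibniz]
    ring

/-- The defining quintic at `w`, written from the position `i` by cyclic symmetry. -/
theorem eval_Fquintic (a b : ℂ) (w : Fin 5 → ℂ) (i : Fin 5) :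
    eval w (Fquintic a b) =
      a ^ 5 * (w i * w (i + 1) * w (i + 2) * w (i + 3) * w (i + 4)) +
        (w i + b * w (i + 1)) * (w (i + 1) + b * w (i + 2)) * (w (i + 2) + b * w (i + 3)) *
          (w (i + 3) + b * w (i + 4)) * (w (i + 4) + b * w i) := by
  fin_cases i <;> simp [Fquintic, Fin.prod_univ_five] <;> ring

/-- Euler's identity for the quintic. -/
theorem sum_mul_eval_pderiv_Fquintic (a b : ℂ) (w : Fin 5 → ℂ) :
    ∑ i, w i * eval w (pderiv i (Fquintic a b)) = 5 * eval w (Fquintic a b) := by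
  simp only [eval_pderiv_Fquintic, eval_Fquintic a b w 0, Fin.sum_univ_five]
  simp
  ring

/-- At a singular point of the torus, consecutive coordinates are in geometric progression. -/
theorem sq_eq_mul_of_eval_pderiv_Fquintic_eq_zero {a b : ℂ} (ha : a ≠ 0) (hb : b ≠ 0)
    {w : Fin 5 → ℂ} (hw : ∀ i, w i ≠ 0) (hF : eval w (Fquintic a b) = 0) {i : Fin 5}
    (hi : eval w (pderiv i (Fquintic a b)) = 0) :
    w i ^ 2 = w (i + 4) * w (i + 1) := by
  rw [eval_Fquintic a b w i] at hF
  rw [eval_pderiv_Fquintic] at hi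
  have hM : a ^ 5 * (w i * w (i + 1) * w (i + 2) * w (i + 3) * w (i + 4)) ≠ 0 := by
    simp [ha, hw]
  have hP : (w (i + 1) + b * w (i + 2)) * (w (i + 2) + b * w (i + 3)) *
      (w (i + 3) + b * w (i + 4)) * b ≠ 0 := by
    refine mul_ne_zero (fun h ↦ hM ?_) hb
    linear_combination hF - (w i + b * w (i + 1)) * (w (i + 4) + b * w i) * h
  refine mul_left_cancel₀ hP ?_
  linear_combination w i * hi - hF

/-- If `a, b ≠ 0` and `ζa + ηb + 1 ≠ 0` for all fifth roots of unity `ζ, η`, then there is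
no point with all coordinates nonzero at which all five partial derivatives of `F` vanish
(smoothness of `Z₂^sp` on the torus `(ℂ*)⁴ ⊂ ℙ⁴`). -/
theorem no_singular_point_on_torus_of_Steinerian (a b : ℂ) (ha : a ≠ 0) (hb : b ≠ 0)
    (hdisc : ∀ ζ η : ℂ, ζ ^ 5 = 1 → η ^ 5 = 1 → ζ * a + η * b + 1 ≠ 0) :
    ¬ ∃ w : Fin 5 → ℂ, (∀ i, w i ≠ 0) ∧ ∀ i : Fin 5, eval w (pderiv i (Fquintic a b)) = 0 := by
  rintro ⟨w, hw, hd⟩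
  have hF : eval w (Fquintic a b) = 0 := by
    have h := sum_mul_eval_pderiv_Fquintic a b w
    simpa [hd] using h.symm
  have hq (i : Fin 5) := sq_eq_mul_of_eval_pderiv_Fquintic_eq_zero ha hb hw hF (hd i)
  obtain ⟨t, ht⟩ : ∃ t, w 1 = t * w 0 := ⟨w 1 / w 0, (div_mul_cancel₀ _ (hw 0)).symm⟩
  have step {x y z : ℂ} (hx : x ≠ 0) (hy : y = t * x) (h : y ^ 2 = x * z) : z = t * y :=
    mul_left_cancel₀ hx (by linear_combination y * hy - h)
  have h2 : w 2 = t * w 1 := step (hw 0) ht (hq 1)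
  have h3 : w 3 = t * w 2 := step (hw 1) h2 (hq 2)
  have h4 : w 4 = t * w 3 := step (hw 2) h3 (hq 3)
  have h0 : w 0 = t * w 4 := step (hw 3) h4 (hq 4)
  have ht5 : t ^ 5 = 1 := by
    refine mul_right_cancel₀ (hw 0) ?_
    linear_combination -h0 - t * h4 - t ^ 2 * h3 - t ^ 3 * h2 - t ^ 4 * ht
  have hprod : (w 0 * w 1 * w 2 * w 3 * w 4) * (a ^ 5 + (1 + t * b) ^ 5) = 0 := by
    have e : (w 0 + b * w 1) * (w 1 + b * w 2) * (w 2 + b * w 3) * (w 3 + b * w 4) *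
        (w 4 + b * w 0) = (w 0 * (1 + t * b)) * (w 1 * (1 + t * b)) * (w 2 * (1 + t * b)) *
        (w 3 * (1 + t * b)) * (w 4 * (1 + t * b)) := by
      congr
      · linear_combination b * ht
      · linear_combination b * h2
      · linear_combination b * h3
      · linear_combination b * h4
      · linear_combination b * h0
    rw [eval_Fquintic a b w 0] at hF
    simp only [zero_add] at hF
    linear_combination hF - e
  have hsum : a ^ 5 + (1 + t * b) ^ 5 = 0 := by simpa [hw] using hprod
  refine hdisc (-(1 + t * b) / a) t ?_ ht5 ?_
  · rw [div_pow, div_eq_one_iff_eq (pow_ne_zero 5 ha)]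
    linear_combination -hsum
  · rw [div_mul_cancel₀ _ ha]
    ring
end

section
/- Let a, b ∈ ℂ with a ≠ 0, b ≠ 0, a⁵ ≠ b⁵, and suppose that ζ·a + η·b + 1 ≠ 0 for all ζ, η ∈ ℂ with ζ⁵ = η⁵ = 1. Define G(λ) = det(λ₁A₁ + λ₂A₂ + λ₃A₃ + λ₄A₄ + λ₅A₅) for λ ∈ ℂ⁵. Then there is no λ ∈ ℂ⁵ with all coordinates λ_i nonzero at which all five partial derivatives ∂G/∂λ_i vanish. (Equivalently, the restriction of the determinantal quintic X̃₀^{sp,♯} to the torus (ℂ*)⁴ ⊂ ℙ⁴_λ is smooth when its discriminant ∏_{k,l=0}^{4}(μᵏa + μˡb + 1)·∏_{k=0}^{4}(a − μᵏb)² does not vanish.) -/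
open Matrix MvPolynomial

/-- The defining quintic `G(λ) = det(λ₁A₁ + ⋯ + λ₅A₅)` of the determinantal quintic
`X̃₀^{sp,♯}`, as a polynomial in the variables `λ_k`. -/
noncomputable def Gquintic (a b : ℂ) : MvPolynomial (Fin 5) ℂ :=
  (Matrix.of fun i j => ∑ k : Fin 5, X k * C (Amat a b k i j)).det

/-- The explicit form of the determinantal quintic. -/
theorem Gquintic_eq (a b : ℂ) :
    Gquintic a b =
      C (1 + a ^ 5 + b ^ 5) * (X 0 * X 1 * X 2 * X 3 * X 4)
      - C (a * b) * (X 0 ^ 2 * X 2 * X 3 * X 4 + X 1 ^ 2 * X 3 * X 4 * X 0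
        + X 2 ^ 2 * X 4 * X 0 * X 1 + X 3 ^ 2 * X 0 * X 1 * X 2 + X 4 ^ 2 * X 1 * X 2 * X 3)
      + C ((a * b) ^ 2) * (X 0 ^ 2 * X 2 ^ 2 * X 4 + X 1 ^ 2 * X 3 ^ 2 * X 0
        + X 2 ^ 2 * X 4 ^ 2 * X 1 + X 3 ^ 2 * X 0 ^ 2 * X 2 + X 4 ^ 2 * X 1 ^ 2 * X 3) := by
  have hM : (Matrix.of fun i j => ∑ k : Fin 5, X k * C (Amat a b k i j) :
      Matrix (Fin 5) (Fin 5) (MvPolynomial (Fin 5) ℂ)) =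
      !![X 0, X 0 * C b, 0, 0, X 4 * C a;
         X 0 * C a, X 1, X 1 * C b, 0, 0;
         0, X 1 * C a, X 2, X 2 * C b, 0;
         0, 0, X 2 * C a, X 3, X 3 * C b;
         X 4 * C b, 0, 0, X 3 * C a, X 4] := by
    ext1 i j
    fin_cases i <;> fin_cases j <;> simp [Amat, Fin.sum_univ_five]
  rw [Gquintic, hM]
  simp [Matrix.det_succ_row_zero, Fin.sum_univ_succ, Fin.succAbove]
  ring

/-- The circulant determinant with entries `1, a, b` vanishes only if one of its eigenvalues
does. -/
theorem circulant_quintic_ne_zero (a b : ℂ)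
    (h : ∀ ζ η : ℂ, ζ ^ 5 = 1 → η ^ 5 = 1 → ζ * a + η * b + 1 ≠ 0) :
    1 + a ^ 5 + b ^ 5 - 5 * (a * b) + 5 * (a * b) ^ 2 ≠ 0 := by
  obtain ⟨e, he⟩ : ∃ e : ℂ, IsPrimitiveRoot e 5 :=
    ⟨_, Complex.isPrimitiveRoot_exp 5 (by norm_num)⟩
  have h5 : e ^ 5 = 1 := he.pow_eq_one
  have hs : 1 + e + e ^ 2 + e ^ 3 + e ^ 4 = 0 := by
    simpa [Finset.sum_range_succ] using he.geom_sum_eq_zero (by norm_num)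
  have hpow (k : ℕ) : (e ^ k) ^ 5 = 1 := by rw [← pow_mul, mul_comm, pow_mul, h5, one_pow]
  have h14 : (e * a + e ^ 4 * b + 1) * (e ^ 4 * a + e * b + 1) =
      1 + (e + e ^ 4) * (a + b) + a ^ 2 + b ^ 2 + (e ^ 2 + e ^ 3) * (a * b) := by
    linear_combination (a ^ 2 + b ^ 2 + e ^ 3 * a * b) * h5
  have h23 : (e ^ 2 * a + e ^ 3 * b + 1) * (e ^ 3 * a + e ^ 2 * b + 1) =
      1 + (e ^ 2 + e ^ 3) * (a + b) + a ^ 2 + b ^ 2 + (e + e ^ 4) * (a * b) := by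
    linear_combination (a ^ 2 + b ^ 2 + e * a * b) * h5
  have hadd : e ^ 2 + e ^ 3 = -1 - (e + e ^ 4) := by linear_combination hs
  have hmul : (e + e ^ 4) ^ 2 = 1 - (e + e ^ 4) := by
    linear_combination (2 + e ^ 3) * h5 + hs
  rw [hadd] at h14 h23
  generalize e + e ^ 4 = p at h14 h23 hmul
  have hprod : 1 + a ^ 5 + b ^ 5 - 5 * (a * b) + 5 * (a * b) ^ 2 =
      (1 * a + 1 * b + 1) * ((e * a + e ^ 4 * b + 1) * (e ^ 4 * a + e * b + 1)) *
        ((e ^ 2 * a + e ^ 3 * b + 1) * (e ^ 3 * a + e ^ 2 * b + 1)) := by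
    rw [h14, h23]
    linear_combination (a + b + 1) * (a + b - a * b) ^ 2 * hmul
  rw [hprod]
  have h1 : (1 : ℂ) ^ 5 = 1 := one_pow 5
  exact mul_ne_zero (mul_ne_zero (h _ _ h1 h1)
    (mul_ne_zero (h _ _ h5 (hpow 4)) (h _ _ (hpow 4) h5)))
    (mul_ne_zero (h _ _ (hpow 2) (hpow 3)) (h _ _ (hpow 3) (hpow 2)))

/-- A cyclic solution of `wⱼ (wⱼ₋₁ + wⱼ₊₁ - 1) = μ` with two distinct neighbours satisfies
`(c - 1)² = 4 ∏ wⱼ`, where `c = ∑ wⱼ - ∑ wⱼ wⱼ₊₁`. -/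
theorem sq_eq_four_mul_prod_of_ne {x y z u v m : ℂ} (hx : x ≠ 0) (hy : y ≠ 0) (hz : z ≠ 0)
    (ex : x * (v + y - 1) = m) (ey : y * (x + z - 1) = m) (ez : z * (y + u - 1) = m)
    (eu : u * (z + v - 1) = m) (ev : v * (u + x - 1) = m) (hxy : x ≠ y) :
    (x + y + z + u + v - (x * y + y * z + z * u + u * v + v * x) - 1) ^ 2 =
      4 * (x * y * z * u * v) := by
  obtain ⟨s, hs⟩ : ∃ s, s = (1 - u) * v * z := ⟨_, rfl⟩
  have sx : (1 - x) * y * v = s := by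
    rw [hs]; linear_combination -v * (ey - ez)
  have sy : (1 - y) * z * x = s := by
    rw [hs]; linear_combination z * (ev - ex)
  have sv : (1 - v) * x * u = s := by
    rw [hs]; linear_combination -u * (ex - ey) - y * (eu - ev) - v * (ey - ez)
  have hx1 : 1 - x ≠ 0 := by
    intro h
    have h0 : (1 - y) * (z * x) = 0 := by linear_combination sy - sx + y * v * h
    have hy1 := (mul_eq_zero.mp h0).resolve_right (mul_ne_zero hz hx)
    exact hxy (by linear_combination hy1 - h)
  have hQ : x * y * (1 - x) * (1 - y) = s * (x + y - x * y) := by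
    apply mul_left_cancel₀ (sub_ne_zero.mpr hxy)
    linear_combination -(x * y * (1 - x) * (1 - y)) * (ex - ey) + x ^ 2 * (1 - y) * sx
      - y ^ 2 * (1 - x) * sy
  have hu' : u = (1 - x) * (1 - y) := by
    apply mul_left_cancel₀ (mul_ne_zero (mul_ne_zero (pow_ne_zero 2 hy) hx1) hx)
    linear_combination y * (1 - x) * (x + y - x * y) * sv + (x + y - x * y) * x * u * sx
      - (x * u + y * (1 - x)) * hQ
  have hE : x + y + z + u + v - (x * y + y * z + z * u + u * v + v * x) - 1 = 2 * s := by
    linear_combination sx + sy + (1 - z - v) * hu'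
  have hP : x * y * z * u * v = s ^ 2 := by
    calc x * y * z * u * v = ((1 - x) * y * v) * ((1 - y) * z * x) := by rw [hu']; ring
      _ = s ^ 2 := by rw [sx, sy, sq]
  rw [hE, hP]
  ring

/-- If `a, b ≠ 0`, `a⁵ ≠ b⁵` and `ζa + ηb + 1 ≠ 0` for all fifth roots of unity `ζ, η`,
then there is no point with all coordinates nonzero at which all five partial derivatives
of `G` vanish (smoothness of `X̃₀^{sp,♯}` on the torus `(ℂ*)⁴ ⊂ ℙ⁴_λ`). -/
theorem no_singular_point_on_torus_of_Hessian_type (a b : ℂ) (ha : a ≠ 0) (hb : b ≠ 0)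
    (hab : a ^ 5 ≠ b ^ 5)
    (hdisc : ∀ ζ η : ℂ, ζ ^ 5 = 1 → η ^ 5 = 1 → ζ * a + η * b + 1 ≠ 0) :
    ¬ ∃ lam : Fin 5 → ℂ, (∀ i, lam i ≠ 0) ∧
      ∀ i : Fin 5, eval lam (pderiv i (Gquintic a b)) = 0 := by
  rintro ⟨l, hl, hG⟩
  have h0 := hG 0
  have h1 := hG 1
  have h2 := hG 2
  have h3 := hG 3
  have h4 := hG 4
  simp [Gquintic_eq, pderiv_X] at h0 h1 h2 h3 h4
  have n0 := hl 0
  have n1 := hl 1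
  have n2 := hl 2
  have n3 := hl 3
  have n4 := hl 4
  generalize l 0 = p0, l 1 = p1, l 2 = p2, l 3 = p3, l 4 = p4 at *
  clear hG hl
  have ht : a * b ≠ 0 := mul_ne_zero ha hb
  have ht5 : a ^ 5 * b ^ 5 = (a * b) ^ 5 := by ring
  obtain ⟨c, hc⟩ : ∃ c, c = 1 + a ^ 5 + b ^ 5 := ⟨_, rfl⟩
  rw [← hc] at h0 h1 h2 h3 h4
  obtain ⟨t, htab⟩ : ∃ t, t = a * b := ⟨_, rfl⟩
  rw [← htab] at h0 h1 h2 h3 h4 ht ht5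
  obtain ⟨v0, e0⟩ : ∃ v, v = t * p0 / p1 := ⟨_, rfl⟩
  obtain ⟨v1, e1⟩ : ∃ v, v = t * p1 / p2 := ⟨_, rfl⟩
  obtain ⟨v2, e2⟩ : ∃ v, v = t * p2 / p3 := ⟨_, rfl⟩
  obtain ⟨v3, e3⟩ : ∃ v, v = t * p3 / p4 := ⟨_, rfl⟩
  obtain ⟨v4, e4⟩ : ∃ v, v = t * p4 / p0 := ⟨_, rfl⟩
  have hv0 : v0 ≠ 0 := by rw [e0]; exact div_ne_zero (mul_ne_zero ht n0) n1
  have hv1 : v1 ≠ 0 := by rw [e1]; exact div_ne_zero (mul_ne_zero ht n1) n2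
  have hv2 : v2 ≠ 0 := by rw [e2]; exact div_ne_zero (mul_ne_zero ht n2) n3
  have hv3 : v3 ≠ 0 := by rw [e3]; exact div_ne_zero (mul_ne_zero ht n3) n4
  have hv4 : v4 ≠ 0 := by rw [e4]; exact div_ne_zero (mul_ne_zero ht n4) n0
  have hprod : v0 * v2 * v4 * v1 * v3 = t ^ 5 := by
    rw [e0, e1, e2, e3, e4]; field_simp
  have hN : p0 * p1 * p2 * p3 * p4 ≠ 0 := by
    simp only [ne_eq, mul_eq_zero, n0, n1, n2, n3, n4, or_self, not_false_eq_true]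
  have hf : v0 + v2 + v4 + v1 + v3 - (v0 * v2 + v2 * v4 + v4 * v1 + v1 * v3 + v3 * v0) = c := by
    apply mul_left_cancel₀ hN
    rw [e0, e1, e2, e3, e4]
    field_simp
    linear_combination (-1 / 5) * (p0 * h0 + p1 * h1 + p2 * h2 + p3 * h3 + p4 * h4)
  have r1 : v1 * (v3 + v4 - 1) = v0 * (v2 + v3 - 1) := by
    apply mul_left_cancel₀ hN
    have : p0 * p1 * p2 * p3 * p4 * (v1 * (v3 + v4 - 1)
        - v0 * (v2 + v3 - 1)
        - (v0 + v2 + v4 + v1 + v3 - (v0 * v2 + v2 * v4 + v4 * v1 + v1 * v3 + v3 * v0)) + c) = 0 := by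
      rw [e0, e1, e2, e3, e4]
      field_simp
      linear_combination p1 * h1
    rw [hf] at this
    linear_combination this
  have r2 : v2 * (v4 + v0 - 1) = v1 * (v3 + v4 - 1) := by
    apply mul_left_cancel₀ hN
    have : p0 * p1 * p2 * p3 * p4 * (v2 * (v4 + v0 - 1)
        - v1 * (v3 + v4 - 1)
        - (v0 + v2 + v4 + v1 + v3 - (v0 * v2 + v2 * v4 + v4 * v1 + v1 * v3 + v3 * v0)) + c) = 0 := by
      rw [e0, e1, e2, e3, e4]
      field_simp
      linear_combination p2 * h2
    rw [hf] at this
    linear_combination this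
  have r3 : v3 * (v0 + v1 - 1) = v2 * (v4 + v0 - 1) := by
    apply mul_left_cancel₀ hN
    have : p0 * p1 * p2 * p3 * p4 * (v3 * (v0 + v1 - 1)
        - v2 * (v4 + v0 - 1)
        - (v0 + v2 + v4 + v1 + v3 - (v0 * v2 + v2 * v4 + v4 * v1 + v1 * v3 + v3 * v0)) + c) = 0 := by
      rw [e0, e1, e2, e3, e4]
      field_simp
      linear_combination p3 * h3
    rw [hf] at this
    linear_combination this
  have r4 : v4 * (v1 + v2 - 1) = v3 * (v0 + v1 - 1) := by
    apply mul_left_cancel₀ hN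
    have : p0 * p1 * p2 * p3 * p4 * (v4 * (v1 + v2 - 1)
        - v3 * (v0 + v1 - 1)
        - (v0 + v2 + v4 + v1 + v3 - (v0 * v2 + v2 * v4 + v4 * v1 + v1 * v3 + v3 * v0)) + c) = 0 := by
      rw [e0, e1, e2, e3, e4]
      field_simp
      linear_combination p4 * h4
    rw [hf] at this
    linear_combination this
  obtain ⟨m, hm⟩ : ∃ m, m = v0 * (v3 + v2 - 1) := ⟨_, rfl⟩
  have q0 : v0 * (v3 + v2 - 1) = m := hm.symm
  have q1 : v1 * (v4 + v3 - 1) = m := by linear_combination r1 + q0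
  have q2 : v2 * (v0 + v4 - 1) = m := by linear_combination r2 + q1
  have q3 : v3 * (v1 + v0 - 1) = m := by linear_combination r3 + q2
  have q4 : v4 * (v2 + v1 - 1) = m := by linear_combination r4 + q3
  have hc4 : (c - 1) ^ 2 ≠ 4 * t ^ 5 := by
    intro h
    rw [← ht5, hc] at h
    have h' : (a ^ 5 - b ^ 5) ^ 2 = 0 := by linear_combination h
    exact hab (sub_eq_zero.mp (pow_eq_zero_iff two_ne_zero |>.mp h'))
  rw [← hf, ← hprod] at hc4
  have d02 : v0 = v2 := by
    by_contra h
    exact hc4 (sq_eq_four_mul_prod_of_ne hv0 hv2 hv4 q0 q2 q4 q1 q3 h)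
  have d24 : v2 = v4 := by
    by_contra h
    exact hc4 (by linear_combination sq_eq_four_mul_prod_of_ne hv2 hv4 hv1 q2 q4 q1 q3 q0 h)
  have d41 : v4 = v1 := by
    by_contra h
    exact hc4 (by linear_combination sq_eq_four_mul_prod_of_ne hv4 hv1 hv3 q4 q1 q3 q0 q2 h)
  have d13 : v1 = v3 := by
    by_contra h
    exact hc4 (by linear_combination sq_eq_four_mul_prod_of_ne hv1 hv3 hv0 q1 q3 q0 q2 q4 h)
  subst d13 d41 d24 d02
  have hw5 : v0 ^ 5 = t ^ 5 := by linear_combination hprod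
  have hz5 : (v0 / t) ^ 5 = 1 := by rw [div_pow, hw5, div_self (pow_ne_zero 5 ht)]
  have hb5 : (v0 / t * b) ^ 5 = b ^ 5 := by rw [mul_pow, hz5, one_mul]
  have hab' : a * (v0 / t * b) = v0 := by
    rw [htab]; field_simp
  refine circulant_quintic_ne_zero a (v0 / t * b) (fun ζ η hζ hη => ?_) ?_
  · have := hdisc ζ (η * (v0 / t)) hζ (by rw [mul_pow, hη, hz5, one_mul])
    rwa [mul_assoc] at this
  · rw [hb5, hab']
    linear_combination -hc - hf
end

section
/- Let a, b ∈ ℂ, let e₁,…,e₅ denote the standard basis of ℂ⁵, and for i ∈ ℤ/5 and s, t ∈ ℂ consider the four families of points (z,w) ∈ ℂ⁵×ℂ⁵: Q_i: z = a²s·e_i − a(s+bt)·e_{i+1} + (s+bt)·e_{i+2}, w = s·e_i + t·e_{i+1}; Q̃_i: z = s·e_i + t·e_{i+1}, w = b²s·e_i − b(s+at)·e_{i+1} + (s+at)·e_{i+2}; L_i: z = e_i, w = −bs·e_i + s·e_{i+1} + t·e_{i+2}; L̃_i: z = −as·e_i + s·e_{i+1} + t·e_{i+2}, w = e_i (all indices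 cyclic mod 5). Then at every such point all five equations f₁(z,w) = … = f₅(z,w) = 0 hold, and the 5×10 Jacobian matrix J(z,w), with J_{k,j} = ∂f_k/∂z_j and J_{k,5+j} = ∂f_k/∂w_j, has rank at most 4. (These families give the 20 lines of singularities of the complete intersection X̃₀^sp.) -/
open Matrix

/-- `(z,w)` lies on the affine cone of `X̃₀^sp` and is a singular point there:
all five equations vanish and the Jacobian has rank at most 4. -/
def IsSingularPoint (a b : ℂ) (z w : Fin 5 → ℂ) : Prop :=
  (∀ k, fEq a b z w k = 0) ∧ (Jac a b z w).rank ≤ 4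

/-- A matrix with a zero row has rank strictly smaller than its number of rows. -/
theorem Matrix.rank_lt_card_of_row_eq_zero {m n K : Type*} [Fintype m] [Fintype n] [Field K]
    (M : Matrix m n K) (k : m) (hk : M k = 0) : M.rank < Fintype.card m := by
  refine lt_of_le_of_ne M.rank_le_card_height fun h => ?_
  rw [Matrix.rank_eq_finrank_span_row] at h
  exact (linearIndependent_iff_card_eq_finrank_span.mpr h.symm).ne_zero k hk

/-- If `z` and `w` both vanish at `k` and `k + 1`, then the `k`-th row of the Jacobian is zero,
so the Jacobian has rank at most 4. -/
theorem Jac_rank_le_four (a b : ℂ) (z w : Fin 5 → ℂ) (k : Fin 5) (hz : z k = 0)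
    (hz' : z (k + 1) = 0) (hw : w k = 0) (hw' : w (k + 1) = 0) : (Jac a b z w).rank ≤ 4 := by
  have h := (Jac a b z w).rank_lt_card_of_row_eq_zero k (by
    ext j
    cases j <;> simp [Jac, hz, hz', hw, hw'])
  rw [Fintype.card_fin] at h
  exact Nat.le_of_lt_succ h

/-- The four families of lines `Q_i`, `Q̃_i`, `L_i`, `L̃_i` (indices cyclic mod 5) consist
of singular points of the complete intersection `X̃₀^sp`: all five equations `f_k = 0` hold
there and the 5×10 Jacobian has rank at most 4. -/
theorem twenty_singular_lines (a b : ℂ) (i : Fin 5) (s t : ℂ) :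
    -- the family Q_i
    IsSingularPoint a b
      (Pi.single i (a ^ 2 * s) + Pi.single (i + 1) (-(a * (s + b * t))) +
        Pi.single (i + 2) (s + b * t))
      (Pi.single i s + Pi.single (i + 1) t) ∧
    -- the family Q̃_i
    IsSingularPoint a b
      (Pi.single i s + Pi.single (i + 1) t)
      (Pi.single i (b ^ 2 * s) + Pi.single (i + 1) (-(b * (s + a * t))) +
        Pi.single (i + 2) (s + a * t)) ∧
    -- the family L_i
    IsSingularPoint a b
      (Pi.single i 1)
      (Pi.single i (-(b * s)) + Pi.single (i + 1) s + Pi.single (i + 2) t) ∧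
    -- the family L̃_i
    IsSingularPoint a b
      (Pi.single i (-(a * s)) + Pi.single (i + 1) s + Pi.single (i + 2) t)
      (Pi.single i 1) := by
  refine ⟨⟨fun k => ?_, Jac_rank_le_four a b _ _ (i + 3) ?_ ?_ ?_ ?_⟩,
    ⟨fun k => ?_, Jac_rank_le_four a b _ _ (i + 3) ?_ ?_ ?_ ?_⟩,
    ⟨fun k => ?_, Jac_rank_le_four a b _ _ (i + 3) ?_ ?_ ?_ ?_⟩,
    ⟨fun k => ?_, Jac_rank_le_four a b _ _ (i + 3) ?_ ?_ ?_ ?_⟩⟩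
  case refine_1 | refine_6 | refine_11 | refine_16 =>
    fin_cases i <;> fin_cases k <;> simp [fEq] <;> ring
  all_goals fin_cases i <;> simp
end

section
/- Let a, b ∈ ℂ with b ≠ 0, let e₁,…,e₅ denote the standard basis of ℂ⁵, and fix i ∈ ℤ/5. Let N be the 5×5 matrix whose k-th column is A_k·e_i. Then the left kernel {z ∈ ℂ⁵ : ᵗz·N = 0} equals the linear span of the three vectors −a·e_i + e_{i+1}, e_{i+2}, and e_{i+3} (indices cyclic mod 5). (This computes the fiber π₂⁻¹([e_i]) ≅ ℙ² of the partial resolution π₂ : X̃₀^sp → Z₂^sp over the coordinate point [e_i].) -/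
open Matrix

/-- Pairing `z` with the column `A_k · e_i`. -/
theorem vecMul_Amat_column (a b : ℂ) (z : Fin 5 → ℂ) (i k : Fin 5) :
    Matrix.vecMul z (Matrix.of fun j k => (Amat a b k).mulVec (Pi.single i 1) j) k =
      (if i = k then z i + a * z (i + 1) else 0) + (if i = k + 1 then b * z k else 0) := by
  simp only [vecMul, dotProduct, of_apply, mulVec_single_one, col_apply, Amat, ite_and, mul_add,
    mul_ite, mul_one, mul_zero, Finset.sum_add_distrib, Finset.sum_ite_eq', Finset.mem_univ, if_true]
  by_cases h : i = k <;> by_cases h' : i = k + 1 <;> simp [h, h', mul_comm]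

/-- The left kernel is cut out by two linear equations. -/
theorem vecMul_Amat_columns_eq_zero_iff (a b : ℂ) (hb : b ≠ 0) (z : Fin 5 → ℂ) (i : Fin 5) :
    Matrix.vecMul z (Matrix.of fun j k => (Amat a b k).mulVec (Pi.single i 1) j) = 0 ↔
      z i = -a * z (i + 1) ∧ z (i + 4) = 0 := by
  have h₁ : i ≠ i + 1 := by revert i; decide
  have h₄ : i ≠ i + 4 := by revert i; decide
  have h₅ : i = i + 4 + 1 := by revert i; decide
  simp only [funext_iff, vecMul_Amat_column, Pi.zero_apply]
  constructor
  · intro h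
    have hi := h i
    have hi' := h (i + 4)
    rw [if_pos rfl, if_neg h₁, add_zero] at hi
    rw [if_neg h₄, if_pos h₅, zero_add] at hi'
    exact ⟨by linear_combination hi, (mul_eq_zero.mp hi').resolve_left hb⟩
  · rintro ⟨h, h'⟩ k
    have hk : i = k + 1 → k = i + 4 := by clear * -; decide +revert
    split_ifs with h₂ h₃ h₃
    · exact absurd (h₂ ▸ h₃) h₁
    · linear_combination h
    · rw [hk h₃, h', mul_zero, add_zero]
    · exact add_zero 0

/-- Let `N` be the 5×5 matrix whose `k`-th column is `A_k · e_i`.  For `b ≠ 0`, the left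
kernel `{z | ᵗz·N = 0}` is the linear span of `−a·e_i + e_{i+1}`, `e_{i+2}` and `e_{i+3}`
(indices cyclic mod 5); this is the fiber `π₂⁻¹([e_i]) ≅ ℙ²`. -/
theorem leftKernel_fiber_over_coordinate_point (a b : ℂ) (hb : b ≠ 0) (i : Fin 5) :
    {z : Fin 5 → ℂ |
        Matrix.vecMul z (Matrix.of fun j k => (Amat a b k).mulVec (Pi.single i 1) j) = 0} =
      ↑(Submodule.span ℂ
        {(-a) • (Pi.single i 1 : Fin 5 → ℂ) + Pi.single (i + 1) 1,
         (Pi.single (i + 2) 1 : Fin 5 → ℂ), (Pi.single (i + 3) 1 : Fin 5 → ℂ)}) := by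
  ext z
  rw [Set.mem_ofPred_eq, vecMul_Amat_columns_eq_zero_iff a b hb, SetLike.mem_coe,
    Submodule.mem_span_triple]
  constructor
  · rintro ⟨h, h'⟩
    refine ⟨z (i + 1), z (i + 2), z (i + 3), funext fun j => ?_⟩
    fin_cases i <;> fin_cases j <;> simp_all [mul_comm]
  · rintro ⟨x, y, w, rfl⟩
    fin_cases i <;> simp [mul_comm]
end

section
/- Let a, b ∈ ℂ with a ≠ 0 and b ≠ 0. Define the two polynomials g₁ = a·t·(u + a·v) + b³·u·w and g₂ = a·w·(v + a·s) − b²·s·v in variables (s,t,u,v,w). Then a nonzero vector (s,t,u,v,w) ∈ ℂ⁵ satisfies g₁ = g₂ = 0 and has 2×5 Jacobian matrix of (g₁,g₂) of rank at most 1 if and only if it is a scalar multiple of one of the three coordinate vectors (1,0,0,0,0), (0,1,0,0,0), (0,0,1,0,0). (Thus the exceptional divisor E₁ = {g₁ = g₂ = 0} ⊂ ℙ⁴, a quartic del Pezzo surface, is singular exactly at the three nodal points [1:0:0:0:0], [0:1:0:0:0], [0:0:1:0:0].) -/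
open Matrix MvPolynomial

/-- `g₁ = a·t·(u + a·v) + b³·u·w` as a polynomial in `(s,t,u,v,w) = (X 0, X 1, X 2, X 3, X 4)`. -/
noncomputable def g1 (a b : ℂ) : MvPolynomial (Fin 5) ℂ :=
  C a * X 1 * (X 2 + C a * X 3) + C (b ^ 3) * X 2 * X 4

/-- `g₂ = a·w·(v + a·s) − b²·s·v` as a polynomial in `(s,t,u,v,w) = (X 0, X 1, X 2, X 3, X 4)`. -/
noncomputable def g2 (a b : ℂ) : MvPolynomial (Fin 5) ℂ :=
  C a * X 4 * (X 3 + C a * X 0) - C (b ^ 2) * X 0 * X 3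

/-- The 2×5 Jacobian matrix of `(g₁, g₂)` evaluated at `p`. -/
noncomputable def JacG (a b : ℂ) (p : Fin 5 → ℂ) : Matrix (Fin 2) (Fin 5) ℂ :=
  Matrix.of fun r j => eval p (pderiv j (![g1 a b, g2 a b] r))

/-- A matrix of rank at most one has vanishing `2 × 2` minors. -/
theorem Matrix.mul_eq_mul_of_rank_le_one {K m n : Type*} [Field K] [Fintype m] [Fintype n]
    {M : Matrix m n K} (h : M.rank ≤ 1) (r s : m) (i j : n) :
    M r i * M s j = M r j * M s i := by
  have hle : (M.submatrix ![r, s] ![i, j]).rank ≤ 1 := (M.rank_submatrix_le _ _).trans h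
  by_contra hne
  have hdet : IsUnit (M.submatrix ![r, s] ![i, j]) := by
    rw [Matrix.isUnit_iff_isUnit_det, isUnit_iff_ne_zero, Matrix.det_fin_two]
    simpa [sub_eq_zero] using hne
  rw [Matrix.rank_of_isUnit _ hdet] at hle
  simp at hle

/-- A matrix with at most one nonzero row has rank at most one. -/
theorem Matrix.rank_le_one_of_rows_eq_zero {K m n : Type*} [Field K] [DecidableEq m]
    [Fintype m] [Fintype n] {M : Matrix m n K} (r : m) (h : ∀ s ≠ r, M s = 0) :
    M.rank ≤ 1 := by
  have hM : M = Matrix.vecMulVec (Pi.single r 1) (M r) := by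
    ext s j
    by_cases hs : s = r
    · subst hs; simp [Matrix.vecMulVec_apply]
    · simp [Matrix.vecMulVec_apply, hs, h s hs]
  rw [hM]
  exact Matrix.rank_vecMulVec_le _ _

theorem eval_g1 (a b : ℂ) (p : Fin 5 → ℂ) :
    eval p (g1 a b) = a * p 1 * (p 2 + a * p 3) + b ^ 3 * p 2 * p 4 := by
  simp [g1]

theorem eval_g2 (a b : ℂ) (p : Fin 5 → ℂ) :
    eval p (g2 a b) = a * p 4 * (p 3 + a * p 0) - b ^ 2 * p 0 * p 3 := by
  simp [g2]

theorem JacG_eq (a b : ℂ) (p : Fin 5 → ℂ) :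
    JacG a b p =
      !![0, a * (p 2 + a * p 3), a * p 1 + b ^ 3 * p 4, a ^ 2 * p 1, b ^ 3 * p 2;
         a ^ 2 * p 4 - b ^ 2 * p 3, 0, 0, a * p 4 - b ^ 2 * p 0, a * (p 3 + a * p 0)] := by
  ext r j
  fin_cases r <;> fin_cases j <;>
    simp [JacG, g1, g2, pderiv_X] <;> ring

/-- A common zero of the two quadrics at which all `2 × 2` minors of the Jacobian vanish lies on
one of the first three coordinate axes. -/
theorem coordinate_axis_of_minors_eq_zero {K : Type*} [Field K] [CharZero K]
    {a b s t u v w : K} (ha : a ≠ 0) (hb : b ≠ 0)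
    (h1 : a * t * (u + a * v) + b ^ 3 * u * w = 0)
    (m01 : a * (u + a * v) * (a ^ 2 * w - b ^ 2 * v) = 0)
    (m02 : (a * t + b ^ 3 * w) * (a ^ 2 * w - b ^ 2 * v) = 0)
    (m03 : a ^ 2 * t * (a ^ 2 * w - b ^ 2 * v) = 0)
    (m04 : b ^ 3 * u * (a ^ 2 * w - b ^ 2 * v) = 0)
    (m13 : a * (u + a * v) * (a * w - b ^ 2 * s) = 0)
    (m14 : a * (u + a * v) * (a * (v + a * s)) = 0)
    (m23 : (a * t + b ^ 3 * w) * (a * w - b ^ 2 * s) = 0)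
    (m24 : (a * t + b ^ 3 * w) * (a * (v + a * s)) = 0) :
    v = 0 ∧ w = 0 ∧ (t = 0 ∧ u = 0 ∨ s = 0 ∧ u = 0 ∨ s = 0 ∧ t = 0) := by
  have hA : a ^ 2 * w - b ^ 2 * v = 0 := by
    by_contra hA
    have ht : t = 0 := by simpa [hA, ha] using m03
    have hu : u = 0 := by simpa [hA, hb] using m04
    have hv : v = 0 := by simpa [hA, ha, hu] using m01
    have hw : w = 0 := by simpa [hA, hb, ht] using m02
    simp [hv, hw] at hA
  have hv_of_hw (hw : w = 0) : v = 0 := by simpa [hw, hb] using hA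
  by_cases hrow : a * w - b ^ 2 * s = 0 ∧ v + a * s = 0
  · obtain ⟨h3, h4⟩ := hrow
    have hw : w = 0 := by
      have : 2 * a ^ 2 * w = 0 := by linear_combination hA + a * h3 + b ^ 2 * h4
      simpa [ha] using this
    have hv := hv_of_hw hw
    have hs : s = 0 := by simpa [hv, ha] using h4
    have htu : t = 0 ∨ u = 0 := by simpa [hv, hw, ha] using h1
    tauto
  · have hU : u + a * v = 0 := by
      by_contra hU
      exact hrow ⟨by simpa [hU, ha] using m13, by simpa [hU, ha] using m14⟩
    have hT : a * t + b ^ 3 * w = 0 := by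
      by_contra hT
      exact hrow ⟨by simpa [hT] using m23, by simpa [hT, ha] using m24⟩
    have hw : w = 0 := by
      have huw : u = 0 ∨ w = 0 := by simpa [hU, hb] using h1
      refine huw.elim (fun hu => ?_) id
      have hv : v = 0 := by simpa [hu, ha] using hU
      simpa [hv, ha] using hA
    have hv := hv_of_hw hw
    have hu : u = 0 := by simpa [hv] using hU
    have ht : t = 0 := by simpa [hw, ha] using hT
    tauto

/-- For `a, b ≠ 0`, a nonzero `p ∈ ℂ⁵` satisfies `g₁(p) = g₂(p) = 0` and has Jacobian of
rank ≤ 1 if and only if it is a scalar multiple of one of the coordinate vectors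
`(1,0,0,0,0)`, `(0,1,0,0,0)`, `(0,0,1,0,0)`: the quartic del Pezzo surface `E₁` is
singular exactly at the three nodes `[1:0:0:0:0]`, `[0:1:0:0:0]`, `[0:0:1:0:0]`. -/
theorem delPezzo_E1_singular_points (a b : ℂ) (ha : a ≠ 0) (hb : b ≠ 0)
    (p : Fin 5 → ℂ) (hp : p ≠ 0) :
    (eval p (g1 a b) = 0 ∧ eval p (g2 a b) = 0 ∧ (JacG a b p).rank ≤ 1) ↔
      ∃ c : ℂ, p = c • (Pi.single 0 1 : Fin 5 → ℂ) ∨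
        p = c • (Pi.single 1 1 : Fin 5 → ℂ) ∨ p = c • (Pi.single 2 1 : Fin 5 → ℂ) := by
  constructor
  · rintro ⟨h1, -, hr⟩
    rw [eval_g1] at h1
    have minor (i j : Fin 5) := Matrix.mul_eq_mul_of_rank_le_one hr 0 1 i j
    rw [JacG_eq] at minor
    have m01 := minor 1 0
    have m02 := minor 2 0
    have m03 := minor 3 0
    have m04 := minor 4 0
    have m13 := minor 1 3
    have m14 := minor 1 4
    have m23 := minor 2 3
    have m24 := minor 2 4
    simp only [Matrix.of_apply, Matrix.cons_val, mul_zero, zero_mul]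
      at m01 m02 m03 m04 m13 m14 m23 m24
    obtain ⟨hv, hw, ⟨ht, hu⟩ | ⟨hs, hu⟩ | ⟨hs, ht⟩⟩ :=
      coordinate_axis_of_minors_eq_zero ha hb h1 m01 m02 m03 m04 m13 m14 m23 m24
    · refine ⟨p 0, .inl ?_⟩
      ext i; fin_cases i <;> simp [*]
    · refine ⟨p 1, .inr (.inl ?_)⟩
      ext i; fin_cases i <;> simp [*]
    · refine ⟨p 2, .inr (.inr ?_)⟩
      ext i; fin_cases i <;> simp [*]
  · rintro ⟨c, rfl | rfl | rfl⟩ <;> rw [eval_g1, eval_g2, JacG_eq]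
    · refine ⟨by simp, by simp, Matrix.rank_le_one_of_rows_eq_zero 1 fun r hr => ?_⟩
      ext j; fin_cases r <;> fin_cases j <;> simp at hr ⊢
    · refine ⟨by simp, by simp, Matrix.rank_le_one_of_rows_eq_zero 0 fun r hr => ?_⟩
      ext j; fin_cases r <;> fin_cases j <;> simp at hr ⊢
    · refine ⟨by simp, by simp, Matrix.rank_le_one_of_rows_eq_zero 0 fun r hr => ?_⟩
      ext j; fin_cases r <;> fin_cases j <;> simp at hr ⊢
end

section
/- Let a ∈ ℂ. There exists a nonzero vector z ∈ ℂ⁵ satisfying z_i² + 2a·z_i·z_{i+1} = 0 for all i ∈ ℤ/5 (indices cyclic mod 5) if and only if (2a)⁵ = −1. In particular, for (2a)⁵ ≠ −1 the involution ([z],[w]) ↦ ([w],[z]) acting on the special complete intersection X̃₀^sp with parameters a = b has no fixed points, while for (2a)⁵ = −1 a fixed point appears. -/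
/-- There is a nonzero `z ∈ ℂ⁵` with `z_i² + 2a·z_i·z_{i+1} = 0` for all `i` (cyclic mod 5)
if and only if `(2a)⁵ = −1`: the exchange involution on `X̃₀^sp` (with `a = b`) is fixed
point free exactly away from the parameter value `(2a)⁵ = −1`, i.e. `x = y = 1/32`. -/
theorem involution_fixed_point_iff (a : ℂ) :
    (∃ z : Fin 5 → ℂ, z ≠ 0 ∧ ∀ i : Fin 5, z i ^ 2 + 2 * a * z i * z (i + 1) = 0) ↔
      (2 * a) ^ 5 = -1 := by
  constructor
  · rintro ⟨z, hz, h⟩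
    obtain ⟨i, hi⟩ := Function.ne_iff.mp hz
    have step (j : Fin 5) (hj : z j ≠ 0) : z j = -(2 * a) * z (j + 1) := by
      apply mul_left_cancel₀ hj
      linear_combination h j
    have iterate (k : ℕ) : z i = (-(2 * a)) ^ k * z (i + Fin.ofNat 5 k) := by
      induction k with
      | zero => simp
      | succ k ih =>
        have hk : z (i + Fin.ofNat 5 k) ≠ 0 := fun h0 => hi (by rw [ih, h0]; simp)
        have hsucc : i + Fin.ofNat 5 (k + 1) = i + Fin.ofNat 5 k + 1 := by
          ext
          simp [Fin.val_add]
          omega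
        rw [hsucc, pow_succ, mul_assoc, ← step _ hk]
        exact ih
    have hcycle : z i = (-(2 * a)) ^ 5 * z i := by simpa using iterate 5
    apply mul_right_cancel₀ hi
    linear_combination hcycle
  · intro h
    refine ⟨![(2 * a) ^ 4, -(2 * a) ^ 3, (2 * a) ^ 2, -(2 * a), 1], ?_, ?_⟩
    · intro h0
      simpa using congrFun h0 4
    · intro i
      fin_cases i <;> simp
      all_goals first | ring1 | linear_combination h
end

section
/- Define c(n,m) = ((n+m)!)⁵ / ((n!)⁵·(m!)⁵) for integers n, m ≥ 0, and set c(n,m) = 0 if n < 0 or m < 0. Then for all integers n, m ≥ 0: (2n³ − 3n²m + 3nm² − 2m³)·c(n,m) = (n+m)²·(2n+3m)·c(n−1,m) − (n+m)²·(3n+2m)·c(n,m−1). (Equivalently, the hypergeometric series w₀(x,y) = Σ_{n,m≥0} c(n,m)xⁿyᵐ is annihilated by the Picard–Fuchs operator 𝒟₁ = 2θ_x³ − 3θ_x²θ_y + 3θ_xθ_y² − 2θ_y³ − (θ_x+θ_y)²{(2θ_x+3θ_y)x − (3θ_x+2θ_y)y}, where θ_x = x∂/∂x, θ_y = y∂/∂y.)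 -/
/-- `c(n,m) = ((n+m)!)⁵ / ((n!)⁵ (m!)⁵)` for `n, m ≥ 0`, and `0` if `n < 0` or `m < 0`. -/
noncomputable def hypCoeff (n m : ℤ) : ℚ :=
  if 0 ≤ n ∧ 0 ≤ m then
    ((n.toNat + m.toNat).factorial : ℚ) ^ 5 /
      ((n.toNat.factorial : ℚ) ^ 5 * (m.toNat.factorial : ℚ) ^ 5)
  else 0

theorem hypCoeff_comm (n m : ℤ) : hypCoeff n m = hypCoeff m n := by
  simp only [hypCoeff, and_comm, add_comm, mul_comm]

/-- Lowering the first index: `(n+m)⁵ c(n-1,m) = n⁵ c(n,m)`. -/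
theorem add_pow_mul_hypCoeff_sub_one {n m : ℤ} (hn : 0 ≤ n) (hm : 0 ≤ m) :
    ((n : ℚ) + m) ^ 5 * hypCoeff (n - 1) m = (n : ℚ) ^ 5 * hypCoeff n m := by
  lift n to ℕ using hn
  lift m to ℕ using hm
  cases n with
  | zero => simp [hypCoeff]
  | succ k =>
    have h : ((k + 1 : ℕ) : ℤ) - 1 = k := by push_cast; ring
    rw [h]
    simp only [hypCoeff, Int.natCast_nonneg, and_self, if_true, Int.toNat_natCast,
      Int.cast_natCast]
    rw [add_right_comm k 1 m, Nat.factorial_succ, Nat.factorial_succ]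
    have hk : (k.factorial : ℚ) ≠ 0 := mod_cast k.factorial_ne_zero
    have hm : (m.factorial : ℚ) ≠ 0 := mod_cast m.factorial_ne_zero
    have hk' : (k : ℚ) + 1 ≠ 0 := mod_cast k.succ_ne_zero
    push_cast
    field_simp
    ring

/-- The coefficients of the hypergeometric series `w₀(x,y)` satisfy the recursion coming
from the Picard–Fuchs operator
`𝒟₁ = 2θ_x³ − 3θ_x²θ_y + 3θ_xθ_y² − 2θ_y³ − (θ_x+θ_y)²{(2θ_x+3θ_y)x − (3θ_x+2θ_y)y}`. -/
theorem hypCoeff_PF_recursion_D1 (n m : ℤ) (hn : 0 ≤ n) (hm : 0 ≤ m) :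
    (2 * (n : ℚ) ^ 3 - 3 * (n : ℚ) ^ 2 * (m : ℚ) + 3 * (n : ℚ) * (m : ℚ) ^ 2
        - 2 * (m : ℚ) ^ 3) * hypCoeff n m =
      ((n : ℚ) + (m : ℚ)) ^ 2 * (2 * (n : ℚ) + 3 * (m : ℚ)) * hypCoeff (n - 1) m -
        ((n : ℚ) + (m : ℚ)) ^ 2 * (3 * (n : ℚ) + 2 * (m : ℚ)) * hypCoeff n (m - 1) := by
  obtain hs | hs := eq_or_ne ((n : ℚ) + m) 0
  · have hs' : n + m = 0 := mod_cast hs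
    obtain rfl : n = 0 := by omega
    obtain rfl : m = 0 := by omega
    simp
  · have h₁ := add_pow_mul_hypCoeff_sub_one hn hm
    have h₂ := add_pow_mul_hypCoeff_sub_one hm hn
    rw [hypCoeff_comm (m - 1), hypCoeff_comm m] at h₂
    refine mul_left_cancel₀ (pow_ne_zero 3 hs) ?_
    linear_combination -(2 * (n : ℚ) + 3 * m) * h₁ + (3 * (n : ℚ) + 2 * m) * h₂
end

section
/- Define c(n,m) = ((n+m)!)⁵ / ((n!)⁵·(m!)⁵) for integers n, m ≥ 0, and set c(n,m) = 0 if n < 0 or m < 0. Then for all integers n, m ≥ 0: (2n² − 3nm + 2m²)·c(n,m) = (2n² + 7nm + 7m²)·c(n−1,m) + (7n² + 7nm + 2m²)·c(n,m−1). (Equivalently, the hypergeometric series w₀(x,y) = Σ_{n,m≥0} c(n,m)xⁿyᵐ is annihilated by the Picard–Fuchs operator 𝒟₂ = 2θ_x² − 3θ_xθ_y + 2θ_y² − (2θ_x² + 7θ_xθ_y + 7θ_y²)x − (7θ_x² + 7θ_xθ_y + 2θ_y²)y, where θ_x = x∂/∂x, θ_y = y∂/∂y.) -/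
/-- Lowering the first index: `(n + m)⁵ c(n - 1, m) = n⁵ c(n, m)`. -/
theorem add_pow_mul_hypCoeff_sub_one_left (n m : ℤ) (hn : 0 ≤ n) (hm : 0 ≤ m) :
    ((n : ℚ) + m) ^ 5 * hypCoeff (n - 1) m = (n : ℚ) ^ 5 * hypCoeff n m := by
  lift n to ℕ using hn
  lift m to ℕ using hm
  rcases n with _ | k
  · simp [hypCoeff]
  · have hk : ((k + 1 : ℕ) : ℤ) - 1 = (k : ℤ) := by push_cast; ring
    have hsucc : k + 1 + m = (k + m) + 1 := by ring
    rw [hk]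
    simp only [hypCoeff, Int.natCast_nonneg, and_self, if_true, Int.toNat_natCast, hsucc,
      Nat.factorial_succ]
    have h₁ : (k.factorial : ℚ) ≠ 0 := by positivity
    have h₂ : (m.factorial : ℚ) ≠ 0 := by positivity
    have h₃ : (k : ℚ) + 1 ≠ 0 := by positivity
    push_cast
    field_simp
    ring

/-- Lowering the second index: `(n + m)⁵ c(n, m - 1) = m⁵ c(n, m)`. -/
theorem add_pow_mul_hypCoeff_sub_one_right (n m : ℤ) (hn : 0 ≤ n) (hm : 0 ≤ m) :
    ((n : ℚ) + m) ^ 5 * hypCoeff n (m - 1) = (m : ℚ) ^ 5 * hypCoeff n m := by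
  rw [hypCoeff_comm n (m - 1), hypCoeff_comm n m, add_comm (n : ℚ)]
  exact add_pow_mul_hypCoeff_sub_one_left m n hm hn

/-- The coefficients of the hypergeometric series `w₀(x,y)` satisfy the recursion coming
from the Picard–Fuchs operator
`𝒟₂ = 2θ_x² − 3θ_xθ_y + 2θ_y² − (2θ_x² + 7θ_xθ_y + 7θ_y²)x − (7θ_x² + 7θ_xθ_y + 2θ_y²)y`. -/
theorem hypCoeff_PF_recursion_D2 (n m : ℤ) (hn : 0 ≤ n) (hm : 0 ≤ m) :
    (2 * (n : ℚ) ^ 2 - 3 * (n : ℚ) * (m : ℚ) + 2 * (m : ℚ) ^ 2) * hypCoeff n m =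
      (2 * (n : ℚ) ^ 2 + 7 * (n : ℚ) * (m : ℚ) + 7 * (m : ℚ) ^ 2) * hypCoeff (n - 1) m +
        (7 * (n : ℚ) ^ 2 + 7 * (n : ℚ) * (m : ℚ) + 2 * (m : ℚ) ^ 2) * hypCoeff n (m - 1) := by
  have hleft := add_pow_mul_hypCoeff_sub_one_left n m hn hm
  have hright := add_pow_mul_hypCoeff_sub_one_right n m hn hm
  rcases (add_nonneg hn hm).eq_or_lt with h | h
  · obtain rfl : n = 0 := by lia
    obtain rfl : m = 0 := by lia
    simp
  · have hpos : ((n : ℚ) + m) ^ 5 ≠ 0 := by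
      have : (0 : ℚ) < (n : ℚ) + m := by exact_mod_cast h
      positivity
    apply mul_left_cancel₀ hpos
    linear_combination
      -(2 * (n : ℚ) ^ 2 + 7 * (n : ℚ) * (m : ℚ) + 7 * (m : ℚ) ^ 2) * hleft -
        (7 * (n : ℚ) ^ 2 + 7 * (n : ℚ) * (m : ℚ) + 2 * (m : ℚ) ^ 2) * hright
end
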